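/- Let ν > 0 and φ ≥ ν be real numbers. Define P : ℝ^d → ℝ^d by P(a) = (|a| − φ)^± · a/|a| for a ≠ 0 and P(0) = 0, where t^± := min(1, max(0, t)). Then P is a monotone vector field: (P(a) − P(a')) · (a − a') ≥ 0 for all a, a' ∈ ℝ^d. -/

import Mathlib

open RealInnerProductSpace Classical

/-- The regularization vector field `P(a) = (|a| − φ)^± a/|a|` (and `P(0) = 0`),
where `t^± = min(1, max(0, t))`. -/
noncomputable def Pvec {d : ℕ} (φ : ℝ) (a : EuclideanSpace ℝ (Fin d)) :
    EuclideanSpace ℝ (Fin d) :=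
  if a = 0 then 0 else (min 1 (max 0 (‖a‖ - φ))) • (‖a‖⁻¹ • a)

/-- A radial field `c(|x|) x` with `c ≥ 0` satisfies the monotonicity inequality between two points
at which `c(|x|) |x|` is ordered as `|x|`. -/
theorem inner_smul_sub_smul_nonneg {E : Type*} [NormedAddCommGroup E] [InnerProductSpace ℝ E]
    {x y : E} {b c : ℝ} (hb : 0 ≤ b) (hc : 0 ≤ c)
    (h : 0 ≤ (b * ‖x‖ - c * ‖y‖) * (‖x‖ - ‖y‖)) :
    0 ≤ ⟪b • x - c • y, x - y⟫ := by
  have hxy : ⟪x, y⟫ ≤ ‖x‖ * ‖y‖ := real_inner_le_norm x y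
  have hmul := mul_le_mul_of_nonneg_left hxy (add_nonneg hb hc)
  simp only [inner_sub_left, inner_sub_right, real_inner_smul_left,
    real_inner_self_eq_norm_sq, real_inner_comm x y]
  linarith

theorem Pvec_eq_smul {d : ℕ} (φ : ℝ) (a : EuclideanSpace ℝ (Fin d)) :
    Pvec φ a = (min 1 (max 0 (‖a‖ - φ)) * ‖a‖⁻¹) • a := by
  unfold Pvec
  split_ifs with h
  · simp [h]
  · rw [smul_smul]

theorem clamp_mul_inv_norm_mul_norm {E : Type*} [NormedAddCommGroup E] {φ : ℝ} (hφ : 0 ≤ φ)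
    (x : E) :
    min 1 (max 0 (‖x‖ - φ)) * ‖x‖⁻¹ * ‖x‖ = min 1 (max 0 (‖x‖ - φ)) := by
  rcases eq_or_ne x 0 with rfl | h
  · simp [hφ]
  · rw [inv_mul_cancel_right₀ (norm_ne_zero_iff.mpr h)]

/-- for `φ ≥ ν > 0`, the vector field `P` is monotone on `ℝ^d`:
`(P(a) − P(a')) · (a − a') ≥ 0` for all `a, a'`. -/
theorem Pvec_monotone
    (d : ℕ) (ν φ : ℝ) (hν : 0 < ν) (hφ : ν ≤ φ)
    (a a' : EuclideanSpace ℝ (Fin d)) :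
    0 ≤ ⟪Pvec φ a - Pvec φ a', a - a'⟫ := by
  have hφ0 : 0 ≤ φ := hν.le.trans hφ
  rw [Pvec_eq_smul, Pvec_eq_smul]
  refine inner_smul_sub_smul_nonneg (by positivity) (by positivity) ?_
  rw [clamp_mul_inv_norm_mul_norm hφ0, clamp_mul_inv_norm_mul_norm hφ0]
  have hmono : Monotone fun t : ℝ => min 1 (max 0 (t - φ)) := fun s t hst => by
    dsimp only
    gcongr
  rcases le_total ‖a‖ ‖a'‖ with h | h
  · exact mul_nonneg_of_nonpos_of_nonpos (sub_nonpos.mpr (hmono h)) (sub_nonpos.mpr h)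
  · exact mul_nonneg (sub_nonneg.mpr (hmono h)) (sub_nonneg.mpr h)
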